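/- arXiv:2508.18176 — 4 statements merged into one kernel-verified Lean document; each statement's English description precedes it below -/
import Mathlib

section
/- Let (W,S) be a Coxeter system and s ∈ S such that W satisfies the nested condition relative to s. Then: (i) for every g ∈ W \ Stab_{H_s^+} and every h ∈ W one has (m_W^s(g) − m_W^s(h))·(m_W^s(g⁻¹h) − m_W^s(g⁻¹)) = 0; and (ii) for every h' ∈ Stab_{H_s^+} and every h ∈ W one has m_W^s(h'h) = m_W^s(h). -/
open Pointwise
open scoped Classical

variable {B : Type*} {W : Type*} [Group W] {M : CoxeterMatrix B}

/-- The positive root `H_s^+` associated to the generator indexed by `i`: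
elements `g` with `l(sg) > l(g)`. -/
def Hp (cs : CoxeterSystem M W) (i : B) : Set W :=
  {g : W | cs.length g < cs.length (cs.simple i * g)}

/-- The negative root `H_s^-`: elements `g` with `l(sg) < l(g)`. -/
def Hm (cs : CoxeterSystem M W) (i : B) : Set W :=
  {g : W | cs.length (cs.simple i * g) < cs.length g}

/-- `g` satisfies one of the six cases of the nested condition relative to `s`. -/
def NestedAt (cs : CoxeterSystem M W) (i : B) (g : W) : Prop :=
  g • Hp cs i = Hp cs i ∨ g • Hp cs i = Hm cs i ∨
  g • Hp cs i ⊂ Hp cs i ∨ g • Hp cs i ⊂ Hm cs i ∨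
  g • Hm cs i ⊂ Hp cs i ∨ g • Hm cs i ⊂ Hm cs i

/-- `W` satisfies the nested condition relative to the generator indexed by `i`. -/
def Nested (cs : CoxeterSystem M W) (i : B) : Prop := ∀ g : W, NestedAt cs i g

/-- The stabilizer `Stab_{H_s^+}` of the positive root. -/
def StabHp (cs : CoxeterSystem M W) (i : B) : Set W :=
  {g : W | g • Hp cs i = Hp cs i}

/-- The multiplier `m_W^s`. -/
noncomputable def mWs (cs : CoxeterSystem M W) (i : B) (g : W) : ℤ :=
  if g ∈ Hp cs i then 1 else -1

namespace CoxeterSystem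

/-- The action of a simple reflection on pairs `(t, e)`: conjugate `t`, and flip the sign `e`
precisely when `t` is that simple reflection. -/
noncomputable def signedConj (cs : CoxeterSystem M W) (i : B) : Function.End (W × ZMod 2) :=
  fun x ↦ (cs.simple i * x.1 * cs.simple i, x.2 + if x.1 = cs.simple i then 1 else 0)

theorem prod_map_signedConj_apply (cs : CoxeterSystem M W) (ω : List B) (t : W) (e : ZMod 2) :
    (ω.map cs.signedConj).prod (t, e) =
      (cs.wordProd ω * t * (cs.wordProd ω)⁻¹, e + (cs.rightInvSeq ω).count t) := by
  induction ω with
  | nil =>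
    change (t, e) = _
    simp
  | cons i ω ih =>
    rw [List.map_cons, List.prod_cons]
    change cs.signedConj i ((ω.map cs.signedConj).prod (t, e)) = _
    rw [ih]
    have h : cs.wordProd ω * t * (cs.wordProd ω)⁻¹ = cs.simple i ↔
        (cs.wordProd ω)⁻¹ * cs.simple i * cs.wordProd ω = t := by
      rw [mul_inv_eq_iff_eq_mul, eq_comm, mul_assoc, inv_mul_eq_iff_eq_mul]
    simp only [signedConj, rightInvSeq, h, wordProd_cons, List.count_cons, beq_iff_eq]
    ext
    · simp [mul_assoc]
    · push_cast
      simp [add_assoc]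

theorem prod_map_reverse_alternatingWord {G : Type*} [Monoid G] (f : B → G) (i j : B) (p : ℕ) :
    ((alternatingWord j i (2 * p)).reverse.map f).prod = (f i * f j) ^ p := by
  induction p with
  | zero => simp [alternatingWord]
  | succ p ih =>
    rw [Nat.mul_succ, alternatingWord_succ, alternatingWord_succ, pow_succ', ← ih]
    simp [mul_assoc]

theorem leftInvSeq_alternatingWord (cs : CoxeterSystem M W) (i j : B) (p : ℕ) :
    cs.leftInvSeq (alternatingWord j i (2 * p)) =
      (List.range (2 * p)).map fun k ↦ cs.simple j * (cs.simple i * cs.simple j) ^ k := by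
  apply List.ext_getElem
  · simp
  · intro k h _
    rw [cs.getElem_leftInvSeq_alternatingWord j i p k (by simpa using h),
      prod_alternatingWord_eq_mul_pow]
    have : (2 * k + 1) / 2 = k := by lia
    simp [this, parity_simps]

theorem even_count_leftInvSeq_alternatingWord (cs : CoxeterSystem M W) (i j : B) (t : W) :
    Even ((cs.leftInvSeq (alternatingWord j i (2 * M i j))).count t) := by
  rw [leftInvSeq_alternatingWord, two_mul, List.range_add, List.map_append, List.map_map,
    List.count_append]
  simp [Function.comp_def, pow_add]

theorem isLiftable_signedConj (cs : CoxeterSystem M W) : M.IsLiftable cs.signedConj := by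
  intro i j
  rw [← prod_map_reverse_alternatingWord]
  funext ⟨t, e⟩
  change _ = (t, e)
  rw [prod_map_signedConj_apply, rightInvSeq_reverse, List.count_reverse,
    (ZMod.natCast_eq_zero_iff_even).2 (cs.even_count_leftInvSeq_alternatingWord i j t)]
  have h := prod_map_reverse_alternatingWord cs.simple i j (M i j)
  rw [simple_mul_simple_pow] at h
  simp only [wordProd, h]
  simp

/-- The parity with which `t` occurs in the left inversion sequence of any word for `w`. -/
noncomputable def inversionParity (cs : CoxeterSystem M W) (w t : W) : ZMod 2 :=
  (cs.lift ⟨cs.signedConj, cs.isLiftable_signedConj⟩ w⁻¹ (t, 0)).2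

theorem inversionParity_wordProd (cs : CoxeterSystem M W) (ω : List B) (t : W) :
    cs.inversionParity (cs.wordProd ω) t = (cs.leftInvSeq ω).count t := by
  have h : cs.lift ⟨cs.signedConj, cs.isLiftable_signedConj⟩ (cs.wordProd ω.reverse) =
      (ω.reverse.map cs.signedConj).prod := by
    rw [wordProd, map_list_prod, List.map_map]
    congr 2
    ext1 i
    exact cs.lift_apply_simple _ i
  rw [inversionParity, ← wordProd_reverse, h, prod_map_signedConj_apply, rightInvSeq_reverse,
    List.count_reverse, zero_add]

theorem leftInvSeq_append (cs : CoxeterSystem M W) (ω ω' : List B) :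
    cs.leftInvSeq (ω ++ ω') =
      cs.leftInvSeq ω ++ (cs.leftInvSeq ω').map (MulAut.conj (cs.wordProd ω)) := by
  induction ω with
  | nil => simp
  | cons i ω ih => simp [leftInvSeq, ih, wordProd_cons, Function.comp_def]

theorem inversionParity_mul (cs : CoxeterSystem M W) (w v t : W) :
    cs.inversionParity (w * v) t =
      cs.inversionParity w t + cs.inversionParity v (w⁻¹ * t * w) := by
  obtain ⟨ω, rfl⟩ := cs.wordProd_surjective w
  obtain ⟨ω', rfl⟩ := cs.wordProd_surjective v
  have h : t = MulAut.conj (cs.wordProd ω) ((cs.wordProd ω)⁻¹ * t * cs.wordProd ω) := by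
    simp [mul_assoc]
  rw [← wordProd_append, inversionParity_wordProd, inversionParity_wordProd,
    inversionParity_wordProd, leftInvSeq_append, List.count_append, Nat.cast_add]
  congr 2
  conv_lhs => rw [h]
  exact List.count_map_of_injective _ _ (MulAut.conj (cs.wordProd ω)).injective _

theorem inversionParity_simple (cs : CoxeterSystem M W) (i : B) (t : W) :
    cs.inversionParity (cs.simple i) t = if t = cs.simple i then 1 else 0 := by
  rw [← wordProd_singleton, inversionParity_wordProd]
  simp [List.count_singleton, eq_comm (a := t)]

theorem isLeftInversion_of_inversionParity_ne_zero (cs : CoxeterSystem M W) {w t : W}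
    (h : cs.inversionParity w t ≠ 0) : cs.IsLeftInversion w t := by
  obtain ⟨ω, hω, rfl⟩ := cs.exists_isReduced w
  refine cs.isLeftInversion_of_mem_leftInvSeq hω ?_
  by_contra ht
  exact h (by rw [inversionParity_wordProd, List.count_eq_zero_of_not_mem ht, Nat.cast_zero])

theorem isLeftDescent_iff_inversionParity_ne_zero (cs : CoxeterSystem M W) (w : W) (i : B) :
    cs.IsLeftDescent w i ↔ cs.inversionParity w (cs.simple i) ≠ 0 := by
  refine ⟨fun hd h ↦ ?_, fun h ↦ (cs.isLeftInversion_of_inversionParity_ne_zero h).2⟩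
  have h' : cs.inversionParity (cs.simple i * w) (cs.simple i) ≠ 0 := by
    rw [inversionParity_mul, inversionParity_simple]
    simp [h]
  have hd' := (cs.isLeftInversion_of_inversionParity_ne_zero h').2
  rw [simple_mul_simple_cancel_left] at hd'
  exact lt_asymm hd hd'

/-- If multiplying by `s` on the right changes whether `s` is a left descent of `w`, then `w`
commutes with `s`. -/
theorem commute_of_isLeftDescent_mul_simple_iff_not (cs : CoxeterSystem M W) {w : W} {i : B}
    (h : ¬(cs.IsLeftDescent (w * cs.simple i) i ↔ cs.IsLeftDescent w i)) :
    Commute w (cs.simple i) := by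
  by_contra hc
  have hne : w⁻¹ * cs.simple i * w ≠ cs.simple i := by
    rw [mul_assoc, Ne, inv_mul_eq_iff_eq_mul]
    exact fun he ↦ hc he.symm
  simp [isLeftDescent_iff_inversionParity_ne_zero, inversionParity_mul, inversionParity_simple,
    hne] at h

theorem isLeftDescent_mul_iff_of_commute (cs : CoxeterSystem M W) {w : W} {i : B}
    (h : Commute w (cs.simple i)) (v : W) :
    cs.IsLeftDescent (w * v) i ↔ ¬(cs.IsLeftDescent w i ↔ cs.IsLeftDescent v i) := by
  have he : w⁻¹ * cs.simple i * w = cs.simple i := by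
    rw [mul_assoc, inv_mul_eq_iff_eq_mul, h.eq]
  simp only [isLeftDescent_iff_inversionParity_ne_zero, inversionParity_mul, he]
  generalize cs.inversionParity w (cs.simple i) = a
  generalize cs.inversionParity v (cs.simple i) = b
  revert a b
  decide

end CoxeterSystem

theorem mem_Hp_iff_not_isLeftDescent (cs : CoxeterSystem M W) (i : B) (g : W) :
    g ∈ Hp cs i ↔ ¬cs.IsLeftDescent g i := by
  have := cs.length_simple_mul_ne g i
  simp only [Hp, Set.mem_ofPred_eq, CoxeterSystem.IsLeftDescent]
  lia

theorem mWs_eq_mWs_iff (cs : CoxeterSystem M W) (i : B) (g h : W) :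
    mWs cs i g = mWs cs i h ↔ (cs.IsLeftDescent g i ↔ cs.IsLeftDescent h i) := by
  simp only [mWs, mem_Hp_iff_not_isLeftDescent]
  split_ifs <;> simp_all

theorem mem_StabHp_iff (cs : CoxeterSystem M W) (i : B) (g : W) :
    g ∈ StabHp cs i ↔ ∀ h, cs.IsLeftDescent (g * h) i ↔ cs.IsLeftDescent h i := by
  simp only [StabHp, Set.mem_ofPred_eq, Set.ext_iff, Set.mem_smul_set_iff_inv_smul_mem, smul_eq_mul,
    mem_Hp_iff_not_isLeftDescent, not_iff_not]
  refine ⟨fun H h ↦ ?_, fun H h ↦ ?_⟩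
  · simpa using (H (g * h)).symm
  · simpa using (H (g⁻¹ * h)).symm

/-- The nested condition at `g`, without strictness: one of the four quarters cut out by the walls
of `H_s^+` and `g • H_s^+` is empty. -/
theorem NestedAt.exists_quarter_empty {cs : CoxeterSystem M W} {i : B} {g : W}
    (hg : NestedAt cs i g) :
    (∀ x, ¬cs.IsLeftDescent (g⁻¹ * x) i → ¬cs.IsLeftDescent x i) ∨
    (∀ x, ¬cs.IsLeftDescent (g⁻¹ * x) i → cs.IsLeftDescent x i) ∨
    (∀ x, cs.IsLeftDescent (g⁻¹ * x) i → ¬cs.IsLeftDescent x i) ∨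
    (∀ x, cs.IsLeftDescent (g⁻¹ * x) i → cs.IsLeftDescent x i) := by
  have key (A C : Set W) (h : g • A ⊆ C) (x : W) (hx : g⁻¹ * x ∈ A) : x ∈ C :=
    h (Set.mem_smul_set_iff_inv_smul_mem.2 hx)
  simp only [← mem_Hp_iff_not_isLeftDescent]
  rcases hg with h | h | h | h | h | h
  · exact .inl (key _ _ h.subset)
  · exact .inr (.inl (key _ _ h.subset))
  · exact .inl (key _ _ h.subset)
  · exact .inr (.inl (key _ _ h.subset))
  · exact .inr (.inr (.inl (key _ _ h.subset)))
  · exact .inr (.inr (.inr (key _ _ h.subset)))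

/-- Theorem A of the paper: if `W` satisfies the nested condition relative to `s`, then the
multiplier `m_W^s` satisfies the Cotlar identity and is left `Stab_{H_s^+}`-invariant. -/
theorem cotlar_identity_and_invariance_of_mWs (cs : CoxeterSystem M W) (i : B)
    (hnest : Nested cs i) :
    (∀ g : W, g ∉ StabHp cs i → ∀ h : W,
      (mWs cs i g - mWs cs i h) * (mWs cs i (g⁻¹ * h) - mWs cs i g⁻¹) = 0) ∧
    (∀ h' ∈ StabHp cs i, ∀ h : W, mWs cs i (h' * h) = mWs cs i h) := by
  refine ⟨fun g hg h ↦ ?_, fun g hg h ↦ (mWs_eq_mWs_iff ..).2 ((mem_StabHp_iff ..).1 hg h)⟩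
  rw [mul_eq_zero, sub_eq_zero, sub_eq_zero, mWs_eq_mWs_iff, mWs_eq_mWs_iff]
  by_cases hc : Commute g (cs.simple i)
  · have key := cs.isLeftDescent_mul_iff_of_commute hc
    have hd : cs.IsLeftDescent g i := by
      by_contra hd
      exact hg ((mem_StabHp_iff ..).2 fun x ↦ by have := key x; tauto)
    have h₁ := key (g⁻¹ * h)
    have h₂ := key g⁻¹
    have := cs.not_isLeftDescent_one i
    rw [mul_inv_cancel_left] at h₁
    rw [mul_inv_cancel] at h₂
    tauto
  · have h₁ : cs.IsLeftDescent (g * cs.simple i) i ↔ cs.IsLeftDescent g i := by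
      by_contra hn
      exact hc (cs.commute_of_isLeftDescent_mul_simple_iff_not hn)
    have h₂ : cs.IsLeftDescent (g⁻¹ * cs.simple i) i ↔ cs.IsLeftDescent g⁻¹ i := by
      by_contra hn
      exact hc (Commute.inv_left_iff.1 (cs.commute_of_isLeftDescent_mul_simple_iff_not hn))
    have hone := cs.not_isLeftDescent_one i
    have hs : cs.IsLeftDescent (cs.simple i) i := by simp [CoxeterSystem.IsLeftDescent]
    rcases (hnest g).exists_quarter_empty with H | H | H | H <;>
    · have e₁ := H 1
      have e₂ := H (cs.simple i)
      have e₃ := H g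
      have e₄ := H (g * cs.simple i)
      have e₅ := H h
      simp only [mul_one, inv_mul_cancel, inv_mul_cancel_left] at e₁ e₃ e₄
      grind
end

section
/- Let (W,S) be a Coxeter system, s ∈ S, and let Γ_s be the set of all g ∈ W satisfying one of the six cases of the nested condition relative to s (Γ_s is the maximal subset of W satisfying the nested condition relative to s). For any subgroup G₀ of W, the multiplier m_W^s satisfies the Cotlar identity relative to G₀, i.e. (m_W^s(g) − m_W^s(h))·(m_W^s(g⁻¹h) − m_W^s(g⁻¹)) = 0 for all g ∈ W \ G₀ and all h ∈ W, if and only if (W \ Γ_s) ∪ Stab_{H_s^+} ⊆ G₀. -/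
open Pointwise
open scoped Classical

variable {B : Type*} {W : Type*} [Group W] {M : CoxeterMatrix B}

/-- The involution of `W × ZMod 2` conjugating the first coordinate by the generator indexed by `i`
and changing the second coordinate exactly when the first one is that generator. -/
noncomputable def signedConj (cs : CoxeterSystem M W) (i : B) : Equiv.Perm (W × ZMod 2) :=
  Function.Involutive.toPerm
    (fun x => (cs.simple i * x.1 * cs.simple i, x.2 + if x.1 = cs.simple i then 1 else 0)) (by
      rintro ⟨t, e⟩
      have h : cs.simple i * t * cs.simple i = cs.simple i ↔ t = cs.simple i := by
        constructor
        · intro h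
          have := congrArg (fun x => cs.simple i * x * cs.simple i) h
          simpa [mul_assoc] using this
        · rintro rfl
          simp
      ext
      · simp [mul_assoc]
      · simp only [h, add_assoc, CharTwo.add_self_eq_zero, add_zero])

lemma signedConj_apply (cs : CoxeterSystem M W) (i : B) (t : W) (e : ZMod 2) :
    signedConj cs i (t, e) =
      (cs.simple i * t * cs.simple i, e + if t = cs.simple i then 1 else 0) := rfl

lemma simple_mul_pow_simple_mul_simple (cs : CoxeterSystem M W) (i j : B) (k : ℕ) :
    cs.simple j * (cs.simple i * cs.simple j) ^ k =
      ((cs.simple i * cs.simple j) ^ k)⁻¹ * cs.simple j := by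
  induction k with
  | zero => simp
  | succ k ih =>
    rw [pow_succ, ← mul_assoc, ih, ← pow_succ, pow_succ']
    simp [mul_assoc]

lemma signedConj_mul_pow_apply (cs : CoxeterSystem M W) (i j : B) (k : ℕ) (t : W) (e : ZMod 2) :
    ((signedConj cs i * signedConj cs j) ^ k) (t, e) =
      ((cs.simple i * cs.simple j) ^ k * t * ((cs.simple i * cs.simple j) ^ k)⁻¹,
        e + ∑ n ∈ Finset.range (2 * k),
          if t = ((cs.simple i * cs.simple j) ^ n)⁻¹ * cs.simple j then 1 else 0) := by
  induction k with
  | zero => simp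
  | succ k ih =>
    rw [pow_succ', Equiv.Perm.mul_apply, ih, Equiv.Perm.mul_apply, signedConj_apply,
      signedConj_apply, show 2 * (k + 1) = 2 * k + 1 + 1 by ring, Finset.sum_range_succ,
      Finset.sum_range_succ]
    have hk := simple_mul_pow_simple_mul_simple cs i j k
    have hp : (cs.simple i * cs.simple j)⁻¹ = cs.simple j * cs.simple i := by simp
    generalize hq : cs.simple i * cs.simple j = p at *
    have h1 : p ^ k * t * (p ^ k)⁻¹ = cs.simple j ↔ t = (p ^ (2 * k))⁻¹ * cs.simple j := by
      rw [mul_inv_eq_iff_eq_mul, hk, ← eq_inv_mul_iff_mul_eq, ← mul_assoc, ← mul_inv_rev,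
        ← pow_add, two_mul]
    have h2 : cs.simple j * (p ^ k * t * (p ^ k)⁻¹) * cs.simple j = cs.simple i ↔
        t = (p ^ (2 * k + 1))⁻¹ * cs.simple j := by
      have : cs.simple j * (p ^ k * t * (p ^ k)⁻¹) * cs.simple j = cs.simple i ↔
          p ^ k * t * (p ^ k)⁻¹ = p⁻¹ * cs.simple j := by
        rw [hp]
        constructor
        · intro h
          rw [← h]
          simp [mul_assoc]
        · intro h
          rw [h]
          simp [mul_assoc]
      rw [this, mul_inv_eq_iff_eq_mul, mul_assoc, hk, ← eq_inv_mul_iff_mul_eq, ← mul_assoc,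
        ← mul_assoc, ← mul_inv_rev, ← mul_inv_rev, ← pow_succ', ← pow_add,
        show k + (k + 1) = 2 * k + 1 by ring]
    simp only [h1, h2, Prod.mk.injEq]
    refine ⟨?_, by ring⟩
    rw [pow_succ', mul_inv_rev, hp, ← hq]
    simp only [mul_assoc]

lemma isLiftable_signedConj (cs : CoxeterSystem M W) : M.IsLiftable (signedConj cs) := by
  intro i j
  ext1 ⟨t, e⟩
  rw [signedConj_mul_pow_apply, two_mul, Finset.sum_range_add]
  simp only [pow_add, cs.simple_mul_simple_pow, one_mul, inv_one, mul_one,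
    CharTwo.add_self_eq_zero, add_zero, Equiv.Perm.one_apply]

/-- The reflection cocycle: `t` is counted modulo two among the walls separating `1` and `w`. -/
lemma exists_reflection_cocycle (cs : CoxeterSystem M W) :
    ∃ η : W → W → ZMod 2, (∀ a b t, η (a * b) t = η a t + η b (a⁻¹ * t * a)) ∧
      (∀ i t, η (cs.simple i) t = if t = cs.simple i then 1 else 0) := by
  obtain ⟨φ, hφ⟩ : ∃ φ : W →* Equiv.Perm (W × ZMod 2), ∀ i, φ (cs.simple i) = signedConj cs i :=
    ⟨cs.lift ⟨signedConj cs, isLiftable_signedConj cs⟩,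
      fun i => cs.lift_apply_simple (isLiftable_signedConj cs) i⟩
  have key : ∀ w t e, φ w (t, e) = (w * t * w⁻¹, e + (φ w (t, 0)).2) := by
    intro w
    induction w using cs.simple_induction with
    | simple i => intro t e; simp [hφ, signedConj_apply]
    | one => simp
    | mul a b ha hb =>
      intro t e
      rw [map_mul, Equiv.Perm.mul_apply, Equiv.Perm.mul_apply, hb t e, hb t 0, ha, ha _ (0 + _)]
      simp [mul_assoc, add_assoc]
  refine ⟨fun w t => (φ w⁻¹ (t, 0)).2, fun a b t => ?_, fun i t => ?_⟩
  · simp only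
    rw [mul_inv_rev, map_mul, Equiv.Perm.mul_apply, key a⁻¹ t 0, key b⁻¹]
    simp
  · simp [hφ, signedConj_apply]

lemma mem_leftInvSeq_of_cocycle_ne_zero (cs : CoxeterSystem M W) {η : W → W → ZMod 2}
    (hmul : ∀ a b t, η (a * b) t = η a t + η b (a⁻¹ * t * a))
    (hs : ∀ i t, η (cs.simple i) t = if t = cs.simple i then 1 else 0) (ω : List B) :
    ∀ t, η (cs.wordProd ω) t ≠ 0 → t ∈ cs.leftInvSeq ω := by
  induction ω with
  | nil =>
    intro t h
    have := hmul 1 1 t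
    simp_all
  | cons i ω ih =>
    intro t h
    rw [cs.wordProd_cons, hmul, hs] at h
    rw [CoxeterSystem.leftInvSeq, List.mem_cons]
    by_cases hti : t = cs.simple i
    · exact Or.inl hti
    · rw [if_neg hti, zero_add] at h
      refine Or.inr (List.mem_map.2 ⟨_, ih _ h, ?_⟩)
      simp [mul_assoc]

lemma mem_Hp_iff_cocycle_eq_zero (cs : CoxeterSystem M W) {η : W → W → ZMod 2}
    (hmul : ∀ a b t, η (a * b) t = η a t + η b (a⁻¹ * t * a))
    (hs : ∀ i t, η (cs.simple i) t = if t = cs.simple i then 1 else 0) (i : B) (w : W) :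
    w ∈ Hp cs i ↔ η w (cs.simple i) = 0 := by
  have key : ∀ v, η v (cs.simple i) ≠ 0 → cs.length (cs.simple i * v) < cs.length v := by
    intro v hv
    obtain ⟨ω, hω, rfl⟩ := cs.exists_isReduced v
    exact (cs.isLeftInversion_of_mem_leftInvSeq hω
      (mem_leftInvSeq_of_cocycle_ne_zero cs hmul hs ω _ hv)).2
  constructor
  · intro hw
    by_contra h
    exact absurd (key w h) (not_lt.2 (le_of_lt hw))
  · intro h
    have := key (cs.simple i * w) (by rw [hmul, hs]; simp [h])
    simpa [Hp] using this

lemma Hm_eq_compl (cs : CoxeterSystem M W) (i : B) : Hm cs i = (Hp cs i)ᶜ := by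
  ext g
  have := cs.length_simple_mul_ne g i
  simp only [Hm, Hp, Set.mem_ofPred_eq, Set.mem_compl_iff]
  omega

lemma mem_Hm (cs : CoxeterSystem M W) (i : B) (x : W) : x ∈ Hm cs i ↔ x ∉ Hp cs i := by
  rw [Hm_eq_compl, Set.mem_compl_iff]

lemma one_mem_Hp (cs : CoxeterSystem M W) (i : B) : (1 : W) ∈ Hp cs i := by
  simp [Hp]

lemma simple_notMem_Hp (cs : CoxeterSystem M W) (i : B) : cs.simple i ∉ Hp cs i := by
  simp [Hp]

lemma simple_mul_mem_Hp_iff (cs : CoxeterSystem M W) (i : B) (w : W) :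
    cs.simple i * w ∈ Hp cs i ↔ w ∉ Hp cs i := by
  have := cs.length_simple_mul_ne w i
  simp only [Hp, Set.mem_ofPred_eq, CoxeterSystem.simple_mul_simple_cancel_left]
  omega

/-- If the wall of the `i`-th generator separates `w` from `w s_i`, with `w` on the positive side,
then `w` preserves the positive root. -/
lemma mul_mem_Hp_iff (cs : CoxeterSystem M W) (i : B) {w : W} (hw : w ∈ Hp cs i)
    (hws : w * cs.simple i ∉ Hp cs i) (u : W) : w * u ∈ Hp cs i ↔ u ∈ Hp cs i := by
  obtain ⟨η, hmul, hs⟩ := exists_reflection_cocycle cs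
  have hmem := mem_Hp_iff_cocycle_eq_zero cs hmul hs i
  simp only [hmem, hmul, hs] at hw hws ⊢
  rw [hw, zero_add] at hws ⊢
  have hc : w⁻¹ * cs.simple i * w = cs.simple i := by
    by_contra h
    exact hws (if_neg h)
  rw [hc]

lemma inv_notMem_Hp_of_maps (cs : CoxeterSystem M W) (i : B) {g : W}
    (hsub : ∀ x, g⁻¹ * x ∈ Hp cs i → x ∈ Hp cs i) (hne : ∃ x ∈ Hp cs i, g⁻¹ * x ∉ Hp cs i) :
    g⁻¹ ∉ Hp cs i := by
  intro hg
  obtain ⟨x, hx, hgx⟩ := hne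
  exact hgx ((mul_mem_Hp_iff cs i hg (fun h => simple_notMem_Hp cs i (hsub _ h)) x).2 hx)

lemma inv_mem_Hp_of_maps_compl (cs : CoxeterSystem M W) (i : B) {g : W}
    (hsub : ∀ x, g⁻¹ * x ∉ Hp cs i → x ∈ Hp cs i) (hne : ∃ x ∈ Hp cs i, g⁻¹ * x ∈ Hp cs i) :
    g⁻¹ ∈ Hp cs i := by
  have h := inv_notMem_Hp_of_maps cs i (g := g * cs.simple i)
    (by simpa [mul_assoc, simple_mul_mem_Hp_iff] using hsub)
    (by simpa [mul_assoc, simple_mul_mem_Hp_iff] using hne)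
  simpa [simple_mul_mem_Hp_iff] using h

lemma mem_smul_Hp (cs : CoxeterSystem M W) (i : B) (g x : W) :
    x ∈ g • Hp cs i ↔ g⁻¹ * x ∈ Hp cs i := by
  rw [Set.mem_smul_set_iff_inv_smul_mem, smul_eq_mul]

lemma mem_smul_Hm (cs : CoxeterSystem M W) (i : B) (g x : W) :
    x ∈ g • Hm cs i ↔ g⁻¹ * x ∉ Hp cs i := by
  rw [Set.mem_smul_set_iff_inv_smul_mem, smul_eq_mul, mem_Hm]

lemma cotlar_eq_zero_iff (cs : CoxeterSystem M W) (i : B) (g h : W) :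
    (mWs cs i g - mWs cs i h) * (mWs cs i (g⁻¹ * h) - mWs cs i g⁻¹) = 0 ↔
      (g ∈ Hp cs i ↔ h ∈ Hp cs i) ∨ (g⁻¹ * h ∈ Hp cs i ↔ g⁻¹ ∈ Hp cs i) := by
  unfold mWs
  split_ifs <;> simp_all

lemma nestedAt_of_cotlar (cs : CoxeterSystem M W) (i : B) {g : W}
    (H : ∀ h, (g ∈ Hp cs i ↔ h ∈ Hp cs i) ∨ (g⁻¹ * h ∈ Hp cs i ↔ g⁻¹ ∈ Hp cs i)) :
    NestedAt cs i g := by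
  have hsub : g • Hp cs i ⊆ Hp cs i ∨ g • Hp cs i ⊆ Hm cs i ∨
      g • Hm cs i ⊆ Hp cs i ∨ g • Hm cs i ⊆ Hm cs i := by
    simp only [Set.subset_def, mem_smul_Hp, mem_smul_Hm, mem_Hm]
    by_cases h1 : g ∈ Hp cs i <;> by_cases h2 : g⁻¹ ∈ Hp cs i <;> grind
  have hcompl : g • Hm cs i = (g • Hp cs i)ᶜ := by
    rw [Hm_eq_compl, Set.smul_set_compl]
  rcases hsub with h | h | h | h <;> rcases h.eq_or_ssubset with h | h
  · exact Or.inl h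
  · exact Or.inr (Or.inr (Or.inl h))
  · exact Or.inr (Or.inl h)
  · exact Or.inr (Or.inr (Or.inr (Or.inl h)))
  · refine Or.inr (Or.inl ?_)
    rw [hcompl] at h
    rw [Hm_eq_compl, compl_eq_comm.1 h]
  · exact Or.inr (Or.inr (Or.inr (Or.inr (Or.inl h))))
  · refine Or.inl ?_
    rwa [hcompl, Hm_eq_compl, compl_inj_iff] at h
  · exact Or.inr (Or.inr (Or.inr (Or.inr (Or.inr h))))

lemma cotlar_of_nestedAt (cs : CoxeterSystem M W) (i : B) {g : W} (hg : NestedAt cs i g)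
    (hst : g ∉ StabHp cs i) (h : W) :
    (g ∈ Hp cs i ↔ h ∈ Hp cs i) ∨ (g⁻¹ * h ∈ Hp cs i ↔ g⁻¹ ∈ Hp cs i) := by
  have h1 := one_mem_Hp cs i
  have hgg : ∀ x, g⁻¹ * (g * x) = x := inv_mul_cancel_left g
  have hgg' : ∀ x, g * (g⁻¹ * x) = x := mul_inv_cancel_left g
  rcases hg with hg | hg | hg | hg | hg | hg
  · exact absurd hg hst
  · simp only [Set.ext_iff, mem_smul_Hp, mem_Hm] at hg
    have := hg 1
    have := hg g
    have := hg h
    simp_all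
    tauto
  · simp only [Set.ssubset_iff_exists, Set.subset_def, mem_smul_Hp] at hg
    have hn := inv_notMem_Hp_of_maps cs i hg.1 hg.2
    have := hg.1 g
    have := hg.1 h
    simp_all
    tauto
  · simp only [Set.ssubset_iff_exists, Set.subset_def, mem_smul_Hp, mem_Hm] at hg
    have := hg.1 1
    have := hg.1 g
    have := hg.1 h
    simp_all
    tauto
  · simp only [Set.ssubset_iff_exists, Set.subset_def, mem_smul_Hm, not_not] at hg
    have hn := inv_mem_Hp_of_maps_compl cs i hg.1 hg.2
    have hn' : g ∈ Hp cs i := by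
      have := inv_mem_Hp_of_maps_compl cs i (g := g⁻¹)
      rw [inv_inv] at this
      obtain ⟨x, hx, hgx⟩ := hg.2
      refine this (fun y hy => ?_) ⟨g⁻¹ * x, hgx, by rwa [hgg']⟩
      by_contra hc
      exact hy (hg.1 _ (by rwa [hgg]))
    have := hg.1 h
    tauto
  · simp only [Set.ssubset_iff_exists, Set.subset_def, mem_smul_Hm, mem_Hm,
      not_imp_not, not_not] at hg
    have hn : g ∉ Hp cs i := by
      have := inv_notMem_Hp_of_maps cs i (g := g⁻¹)
      rw [inv_inv] at this
      obtain ⟨x, hx, hgx⟩ := hg.2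
      exact this (fun y hy => hgg y ▸ hg.1 _ hy) ⟨g⁻¹ * x, hgx, by rwa [hgg']⟩
    have := hg.1 1
    have := hg.1 h
    simp_all
    tauto

/-- The multiplier `m_W^s` satisfies the Cotlar identity relative to a subgroup `G₀` if and only
if `(W \ Γ_s) ∪ Stab_{H_s^+} ⊆ G₀`, where `Γ_s` is the maximal subset of `W` satisfying the
nested condition relative to `s`. -/
theorem cotlar_iff_complement_subset (cs : CoxeterSystem M W) (i : B) (G₀ : Subgroup W) :
    (∀ g : W, g ∉ G₀ → ∀ h : W,
      (mWs cs i g - mWs cs i h) * (mWs cs i (g⁻¹ * h) - mWs cs i g⁻¹) = 0) ↔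
    (Set.univ \ {g : W | NestedAt cs i g}) ∪ StabHp cs i ⊆ (G₀ : Set W) := by
  simp only [cotlar_eq_zero_iff]
  constructor
  · rintro H g (⟨-, hg⟩ | hg)
    · by_contra hG
      exact hg (nestedAt_of_cotlar cs i (H g hG))
    · by_contra hG
      have h1 := one_mem_Hp cs i
      have h2 := simple_notMem_Hp cs i
      simp only [StabHp, Set.mem_ofPred_eq, Set.ext_iff, mem_smul_Hp] at hg
      have h3 := hg g
      have h4 := hg 1
      have h5 := hg (cs.simple i)
      have h6 := H g hG (cs.simple i)
      simp_all
  · intro H g hG h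
    refine cotlar_of_nestedAt cs i ?_ (fun hst => hG (H (Or.inr hst))) h
    by_contra hn
    exact hG (H (Or.inl ⟨trivial, hn⟩))
end

section
/- Let (W,S) be a Coxeter system and s ∈ S. Then W satisfies the nested condition relative to s if and only if for every u ∈ S \ {s} the Coxeter matrix entry m_{su} belongs to {2, ∞} (i.e. either su = us, or su has infinite order). -/
open Pointwise
open scoped Classical

variable {B : Type*} {W : Type*} [Group W] {M : CoxeterMatrix B}

/-! ### The geometric representation -/

namespace CoxeterMatrix

variable (M)

/-- The simple coroots of the geometric representation on `B →₀ ℝ`. -/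
noncomputable def coroot (i : B) : Module.Dual ℝ (B →₀ ℝ) :=
  Finsupp.linearCombination ℝ fun j ↦ -2 * Real.cos (Real.pi / M i j)

theorem coroot_single (i j : B) :
    M.coroot i (Finsupp.single j 1) = -2 * Real.cos (Real.pi / M i j) := by
  simp [coroot]

theorem coroot_single_self (i : B) : M.coroot i (Finsupp.single i 1) = 2 := by
  simp [coroot_single]

/-- The simple reflections of the geometric representation. -/
noncomputable def geomReflection (i : B) : (B →₀ ℝ) ≃ₗ[ℝ] (B →₀ ℝ) :=
  Module.reflection (M.coroot_single_self i)

open Polynomial.Chebyshev in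
theorem isLiftable_geomReflection : M.IsLiftable M.geomReflection := by
  intro i j
  ext1 z
  obtain hm | hm | hm | hm : M i j = 0 ∨ M i j = 1 ∨ M i j = 2 ∨ 3 ≤ M i j := by lia
  · simp [hm]
  · obtain rfl : i = j := by
      by_contra hij
      exact M.off_diagonal i j hij hm
    have h := Module.involutive_reflection (M.coroot_single_self i) z
    simpa [hm, geomReflection] using h
  · have hm' : M j i = 2 := by rw [M.symmetric, hm]
    rw [hm, pow_two]
    simp only [geomReflection, LinearEquiv.mul_apply, Module.reflection_apply, map_sub, map_smul,
      coroot_single, hm, hm', M.diagonal]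
    simp only [Nat.cast_ofNat, Real.cos_pi_div_two, Nat.cast_one, div_one, Real.cos_pi]
    simp only [LinearEquiv.coe_one, id_eq]
    module
  · have hm' : M j i = M i j := M.symmetric j i
    set m := M i j with hmdef
    set θ : ℝ := 2 * Real.pi / m with hθ
    have hm0 : (3 : ℝ) ≤ m := by exact_mod_cast hm
    have hmθ : m * θ = 2 * Real.pi := by rw [hθ]; field_simp
    have hsin : Real.sin θ ≠ 0 := by
      refine (Real.sin_pos_of_pos_of_lt_pi (by positivity) ?_).ne'
      rw [hθ, div_lt_iff₀ (by positivity)]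
      nlinarith [Real.pi_pos]
    have ht : 2 * Real.cos θ = M.coroot i (Finsupp.single j 1) *
        M.coroot j (Finsupp.single i 1) - 2 := by
      have h2 : θ = 2 * (Real.pi / m) := by rw [hθ]; ring
      rw [coroot_single, coroot_single, hm', h2, Real.cos_two_mul]
      ring
    have hS (k : ℤ) : (S ℝ k).eval (2 * Real.cos θ) = Real.sin ((k + 1) * θ) / Real.sin θ := by
      rw [eq_div_iff hsin, S_two_mul_real_cos]
    refine (Module.reflection_mul_reflection_pow_apply (M.coroot_single_self i)
      (M.coroot_single_self j) m z _ ht).trans ?_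
    obtain ⟨k, hk | hk⟩ := m.even_or_odd'
    · have h1 : ((m : ℤ) - 1) / 2 = k - 1 := by lia
      have h2 : ((m : ℤ) - 2) / 2 = k - 1 := by lia
      have h0 : (S ℝ (k - 1)).eval (2 * Real.cos θ) = 0 := by
        have : (((k : ℤ) - 1 : ℤ) + 1 : ℝ) * θ = Real.pi := by
          have hk' : (m : ℝ) = 2 * k := by exact_mod_cast hk
          push_cast
          rw [hk'] at hmθ
          linarith
        rw [hS, this]
        simp
      rw [h1, h2, h0]
      simp
    · have h1 : ((m : ℤ) - 1) / 2 = k := by lia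
      have h2 : ((m : ℤ) - 2) / 2 = k - 1 := by lia
      have h3 : ((m : ℤ) - 3) / 2 = k - 1 := by lia
      have h4 : (m : ℤ) / 2 = k := by lia
      have h0 : (S ℝ k).eval (2 * Real.cos θ) + (S ℝ (k - 1)).eval (2 * Real.cos θ) = 0 := by
        have : ((k : ℤ) + 1 : ℝ) * θ = 2 * Real.pi - (((k : ℤ) - 1 : ℤ) + 1 : ℝ) * θ := by
          have hk' : (m : ℝ) = 2 * k + 1 := by exact_mod_cast hk
          push_cast
          rw [hk'] at hmθ
          linarith
        rw [hS, hS, this, Real.sin_two_pi_sub]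
        ring
      rw [h1, h2, h3, h4, h0]
      simp

end CoxeterMatrix

namespace CoxeterSystem

/-- The geometric representation of a Coxeter system. -/
noncomputable def geomRep (cs : CoxeterSystem M W) : W →* ((B →₀ ℝ) ≃ₗ[ℝ] (B →₀ ℝ)) :=
  cs.lift ⟨M.geomReflection, M.isLiftable_geomReflection⟩

theorem geomRep_simple_apply (cs : CoxeterSystem M W) (i : B) (v : B →₀ ℝ) :
    cs.geomRep (cs.simple i) v = v - M.coroot i v • Finsupp.single i 1 := by
  rw [geomRep, cs.lift_apply_simple, CoxeterMatrix.geomReflection, Module.reflection_apply]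

theorem simple_ne_simple (cs : CoxeterSystem M W) {i j : B} (hij : i ≠ j) :
    cs.simple i ≠ cs.simple j := by
  intro h
  have h1 := cs.geomRep_simple_apply i (Finsupp.single j 1)
  rw [h, cs.geomRep_simple_apply, M.coroot_single_self] at h1
  have h2 := DFunLike.congr_fun h1 j
  norm_num [hij.symm] at h2

theorem simple_mul_simple_mul_simple_ne (cs : CoxeterSystem M W) {i j : B} (hij : i ≠ j)
    (hm : 3 ≤ M i j) (k : B) : cs.simple i * cs.simple j * cs.simple i ≠ cs.simple k := by
  intro h
  set v := cs.geomRep (cs.simple i) (Finsupp.single j 1) with hv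
  have hcos : 0 < Real.cos (Real.pi / M i j) := by
    have hm' : (3 : ℝ) ≤ M i j := by exact_mod_cast hm
    refine Real.cos_pos_of_mem_Ioo ⟨?_, ?_⟩
    · linarith [Real.pi_pos, show 0 ≤ Real.pi / M i j by positivity]
    · rw [div_lt_div_iff₀ (by positivity) (by positivity)]
      nlinarith [Real.pi_pos]
  have hvj : v j = 1 := by
    rw [hv, geomRep_simple_apply]
    simp [hij.symm]
  have hvi : 0 < v i := by
    rw [hv, geomRep_simple_apply, M.coroot_single]
    simp [hij, hcos]
  have h1 : cs.geomRep (cs.simple k) v = -v := by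
    have h2 : cs.geomRep (cs.simple i) v = Finsupp.single j 1 := by
      rw [hv, ← LinearEquiv.mul_apply, ← map_mul, cs.simple_mul_simple_self, map_one,
        LinearEquiv.coe_one, id_eq]
    rw [← h, map_mul, map_mul, LinearEquiv.mul_apply, LinearEquiv.mul_apply, h2,
      geomRep_simple_apply cs j, M.coroot_single_self, hv, ← map_neg]
    congr 1
    module
  rw [geomRep_simple_apply] at h1
  by_cases hk : k = i
  · have h2 := DFunLike.congr_fun h1 j
    simp [hk, hij.symm, hvj] at h2
    norm_num at h2
  · have h2 := DFunLike.congr_fun h1 i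
    simp [Ne.symm hk] at h2
    linarith

end CoxeterSystem

/-! ### Roots -/

theorem compl_Hp (cs : CoxeterSystem M W) (i : B) : (Hp cs i)ᶜ = Hm cs i := by
  ext g
  have := cs.length_simple_mul_ne g i
  simp only [Hp, Hm, Set.mem_compl_iff, Set.mem_ofPred_eq]
  lia

theorem simple_smul_Hp (cs : CoxeterSystem M W) (i : B) : cs.simple i • Hp cs i = Hm cs i := by
  ext g
  simp [Set.mem_smul_set_iff_inv_smul_mem, Hp, Hm]

theorem not_smul_ssubset_of_pow_eq_one {G : Type*} [Group G] {g : G} {n : ℕ} (hn : n ≠ 0)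
    (hg : g ^ n = 1) (A : Set G) : ¬ g • A ⊂ A := by
  intro h
  have key (k : ℕ) : g ^ (k + 1) • A ⊂ A := by
    induction k with
    | zero => simpa using h
    | succ k ih =>
      rw [pow_succ', mul_smul]
      exact (Set.smul_set_mono ih.subset).trans_ssubset h
  obtain ⟨k, rfl⟩ := Nat.exists_eq_succ_of_ne_zero hn
  have := key k
  rw [hg, one_smul] at this
  exact this.ne rfl

theorem eq_two_or_zero_of_nested (cs : CoxeterSystem M W) {i j : B} (hij : j ≠ i)
    (h : NestedAt cs i (cs.simple j)) : M i j = 2 ∨ M i j = 0 := by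
  by_contra! hm
  have hm3 : 3 ≤ M i j := by
    have := M.off_diagonal i j hij.symm
    lia
  have hsq : cs.simple j ^ 2 = 1 := by rw [pow_two, cs.simple_mul_simple_self]
  rcases h with h | h | h | h | h | h
  · have h1 : cs.simple i ∈ Hm cs i := by simp [Hm]
    have h2 : cs.simple j * cs.simple i ∈ Hm cs i := by
      rw [← compl_Hp, ← h, ← Set.smul_set_compl, compl_Hp]
      exact Set.smul_mem_smul_set h1
    have h3 : cs.length (cs.simple i * (cs.simple j * cs.simple i)) <
      cs.length (cs.simple j * cs.simple i) := h2
    have h4 := cs.length_mul_le (cs.simple j) (cs.simple i)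
    have h5 := cs.length_mul_mod_two (cs.simple i) (cs.simple j * cs.simple i)
    have h6 := cs.length_mul_mod_two (cs.simple j) (cs.simple i)
    simp only [cs.length_simple] at h4 h5 h6
    obtain ⟨k, hk⟩ := cs.length_eq_one_iff.1
      (show cs.length (cs.simple i * (cs.simple j * cs.simple i)) = 1 by lia)
    exact cs.simple_mul_simple_mul_simple_ne hij.symm hm3 k (by rw [← hk, mul_assoc])
  · have h1 : (1 : W) ∈ Hp cs i := by simp [Hp]
    have h2 : cs.simple j * 1 ∈ Hm cs i := h ▸ Set.smul_mem_smul_set h1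
    have h3 : cs.length (cs.simple i * (cs.simple j * 1)) < cs.length (cs.simple j * 1) := h2
    rw [mul_one, cs.length_simple, Nat.lt_one_iff, cs.length_eq_zero_iff, mul_eq_one_iff_eq_inv,
      cs.inv_simple] at h3
    exact cs.simple_ne_simple hij.symm h3
  · exact not_smul_ssubset_of_pow_eq_one two_ne_zero hsq _ h
  · refine not_smul_ssubset_of_pow_eq_one hm.2 (cs.simple_mul_simple_pow i j) (Hp cs i) ?_
    rw [← simple_smul_Hp] at h
    have h' : cs.simple i • cs.simple j • Hp cs i ⊂ cs.simple i • cs.simple i • Hp cs i :=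
      (MulAction.injective (cs.simple i)).image_strictMono h
    rwa [smul_smul, smul_smul, cs.simple_mul_simple_self, one_smul] at h'
  · rw [← simple_smul_Hp, smul_smul] at h
    exact not_smul_ssubset_of_pow_eq_one hm.2 (cs.simple_mul_simple_pow' i j) _ h
  · exact not_smul_ssubset_of_pow_eq_one two_ne_zero hsq _ h

/-! ### The action on reduced lists -/

/-- Lists over `α` without equal neighbours. -/
abbrev ReducedList (α : Type*) : Type _ := {l : List α // l.IsChain (· ≠ ·)}

/-- Remove the head of a list if it is `a`, and prepend `a` otherwise. -/
noncomputable def toggleHead {α : Type*} (a : α) (l : List α) : List α :=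
  if l.head? = some a then l.tail else a :: l

namespace ReducedList

variable {α G : Type*} [Group G]

theorem isChain_toggleHead (a : α) {l : List α} (hl : l.IsChain (· ≠ ·)) :
    (toggleHead a l).IsChain (· ≠ ·) := by
  unfold toggleHead
  split_ifs with h
  · exact hl.tail
  · refine List.isChain_cons.2 ⟨?_, hl⟩
    rintro y hy rfl
    exact h hy

/-- The map `toggleHead a` on reduced lists. -/
noncomputable def toggle (a : α) : Function.End (ReducedList α) :=
  fun l ↦ ⟨toggleHead a l.1, isChain_toggleHead a l.2⟩

theorem toggleHead_toggleHead (a : α) {l : List α} (hl : l.IsChain (· ≠ ·)) :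
    toggleHead a (toggleHead a l) = l := by
  cases l with
  | nil => simp [toggleHead]
  | cons b l =>
    by_cases hb : b = a
    · subst hb
      have : l.head? ≠ some b := fun h ↦ (List.isChain_cons.1 hl).1 b h rfl
      simp [toggleHead, this]
    · simp [toggleHead, hb]

theorem toggle_toggle (a : α) (l : ReducedList α) : toggle a (toggle a l) = l :=
  Subtype.ext (toggleHead_toggleHead a l.2)

theorem isChain_map_conj (g : G) {l : List G} (hl : l.IsChain (· ≠ ·)) :
    (l.map (MulAut.conj g)).IsChain (· ≠ ·) := by
  rw [List.isChain_map]
  exact hl.imp fun a b hab h ↦ hab ((MulAut.conj g).injective h)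

/-- Conjugation of all entries of a reduced list over a group. -/
def conj : G →* Function.End (ReducedList G) where
  toFun g l := ⟨l.1.map (MulAut.conj g), isChain_map_conj g l.2⟩
  map_one' := by
    funext l
    refine Subtype.ext ?_
    change l.1.map _ = l.1
    rw [map_one]
    exact List.map_id _
  map_mul' g h := by
    funext l
    refine Subtype.ext ?_
    change l.1.map _ = (l.1.map _).map _
    rw [List.map_map, map_mul]
    rfl

theorem coe_conj_apply (g : G) (l : ReducedList G) : (conj g l).1 = l.1.map (MulAut.conj g) := rfl

theorem conj_toggle {g a : G} (h : Commute g a) (l : ReducedList G) :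
    conj g (toggle a l) = toggle a (conj g l) := by
  obtain ⟨l, hl⟩ := l
  have ha : MulAut.conj g a = a := by simp [h.eq]
  refine Subtype.ext ?_
  change (toggleHead a l).map _ = toggleHead a (l.map _)
  cases l with
  | nil => simp [toggleHead, h.eq]
  | cons b l =>
    have hb : MulAut.conj g b = a ↔ b = a := by
      rw [← (MulAut.conj g).injective.eq_iff (a := b) (b := a), ha]
    by_cases hba : b = a
    · subst hba
      simp [toggleHead, h.eq]
    · have hb' := mt hb.1 hba
      simp only [MulAut.conj_apply] at hb' ha
      simp [toggleHead, hba, hb', ha]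

/-- One of the lists is obtained from the other by appending `q`. -/
def Adjacent (q : α) (x y : ReducedList α) : Prop := y.1 = x.1 ++ [q] ∨ x.1 = y.1 ++ [q]

theorem toggleHead_append (a q : α) (l : List α) :
    toggleHead a (l ++ [q]) = toggleHead a l ++ [q] ∨
      toggleHead a l = toggleHead a (l ++ [q]) ++ [q] := by
  cases l with
  | nil => by_cases h : q = a <;> simp [toggleHead, h]
  | cons b l => by_cases h : b = a <;> simp [toggleHead, h]

theorem Adjacent.toggle {q : α} {x y : ReducedList α} (h : Adjacent q x y) (a : α) :
    Adjacent q (toggle a x) (toggle a y) := by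
  obtain ⟨x, hx⟩ := x
  obtain ⟨y, hy⟩ := y
  rcases h with rfl | rfl
  · exact toggleHead_append a q x
  · exact (toggleHead_append a q y).symm

theorem Adjacent.conj {q : G} {x y : ReducedList G} (h : Adjacent q x y) (g : G) :
    Adjacent (g * q * g⁻¹) (conj g x) (conj g y) := by
  simp only [Adjacent, coe_conj_apply]
  rcases h with h | h <;> simp [h]

theorem prod_toggleHead {a : G} (ha : a * a = 1) (l : List G) :
    (toggleHead a l).prod = a * l.prod := by
  cases l with
  | nil => simp [toggleHead]
  | cons b l =>
    by_cases h : b = a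
    · subst h
      simp [toggleHead, ← mul_assoc, ha]
    · simp [toggleHead, h]

theorem prod_map_conj (g : G) (l : List G) :
    (l.map (MulAut.conj g)).prod = g * l.prod * g⁻¹ := by
  rw [← map_list_prod, MulAut.conj_apply]

theorem prefix_toggleHead_of_head_ne {a : α} {p l : List α} (hp : p ≠ []) (hpa : p.head? ≠ some a) :
    p <+: toggleHead a l ↔ a :: p <+: l := by
  obtain ⟨c, p, rfl⟩ := List.exists_cons_of_ne_nil hp
  have hca : c ≠ a := by simpa using hpa
  cases l with
  | nil => simp [toggleHead, List.cons_prefix_cons, hca]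
  | cons b l =>
    by_cases h : b = a
    · subst h
      simp [toggleHead, List.cons_prefix_cons]
    · simp [toggleHead, List.cons_prefix_cons, h, hca, Ne.symm h]

theorem singleton_prefix_toggleHead (a : α) {l : List α} (hl : l.IsChain (· ≠ ·)) :
    [a] <+: toggleHead a l ↔ ¬ [a] <+: l := by
  cases l with
  | nil => simp [toggleHead]
  | cons b l =>
    by_cases h : b = a
    · subst h
      have : l.head? ≠ some b := fun h ↦ (List.isChain_cons.1 hl).1 b h rfl
      cases l with
      | nil => simp [toggleHead]
      | cons c l => simpa [toggleHead, List.cons_prefix_cons, eq_comm] using this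
    · simp [toggleHead, List.cons_prefix_cons, h, Ne.symm h]

/-- The reduced lists with prefix `p`. -/
def cylinder (p : ReducedList α) : Set (ReducedList α) := {x | p.1 <+: x.1}

/-- Cylinders of nonempty reduced lists, and their complements. -/
def IsHalfSpace (A : Set (ReducedList α)) : Prop :=
  ∃ p : ReducedList α, p.1 ≠ [] ∧ (A = cylinder p ∨ A = (cylinder p)ᶜ)

theorem IsHalfSpace.compl {A : Set (ReducedList α)} (hA : IsHalfSpace A) : IsHalfSpace Aᶜ := by
  obtain ⟨p, hp, rfl | rfl⟩ := hA
  · exact ⟨p, hp, .inr rfl⟩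
  · exact ⟨p, hp, .inl (compl_compl _)⟩

theorem isHalfSpace_preimage_toggle (a : α) {A : Set (ReducedList α)} (hA : IsHalfSpace A) :
    IsHalfSpace (toggle a ⁻¹' A) := by
  suffices H : ∀ p : ReducedList α, p.1 ≠ [] → IsHalfSpace (toggle a ⁻¹' cylinder p) by
    obtain ⟨p, hp, rfl | rfl⟩ := hA
    · exact H p hp
    · exact (H p hp).compl
  rintro ⟨p, hpc⟩ hp
  by_cases hpa : p.head? = some a
  · obtain ⟨p, rfl⟩ := List.head?_eq_some_iff.1 hpa
    have hpa' : p.head? ≠ some a := fun h ↦ (List.isChain_cons.1 hpc).1 a h rfl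
    by_cases hp' : p = []
    · subst hp'
      exact ⟨⟨[a], hpc⟩, hp, .inr (Set.ext fun x ↦ singleton_prefix_toggleHead a x.2)⟩
    · refine ⟨⟨p, hpc.tail⟩, hp', .inl (Set.ext fun x ↦ ?_)⟩
      have := prefix_toggleHead_of_head_ne hp' hpa' (l := toggleHead a x.1)
      rw [toggleHead_toggleHead a x.2] at this
      exact this.symm
  · refine ⟨⟨a :: p, ?_⟩, by simp,
      .inl (Set.ext fun x ↦ prefix_toggleHead_of_head_ne hp hpa)⟩
    refine List.isChain_cons.2 ⟨?_, hpc⟩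
    rintro y hy rfl
    exact hpa hy

theorem isHalfSpace_preimage_conj (g : G) {A : Set (ReducedList G)} (hA : IsHalfSpace A) :
    IsHalfSpace (conj g ⁻¹' A) := by
  suffices H : ∀ p : ReducedList G, p.1 ≠ [] → IsHalfSpace (conj g ⁻¹' cylinder p) by
    obtain ⟨p, hp, rfl | rfl⟩ := hA
    · exact H p hp
    · exact (H p hp).compl
  intro p hp
  have key (g : G) (p x : ReducedList G) (h : p.1 <+: x.1) : (conj g p).1 <+: (conj g x).1 :=
    h.map _
  have hinv (g : G) (x : ReducedList G) : conj g⁻¹ (conj g x) = x := by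
    change (conj g⁻¹ * conj g) x = x
    rw [← map_mul, inv_mul_cancel, map_one]
    rfl
  refine ⟨conj g⁻¹ p, by simpa [coe_conj_apply] using hp,
    .inl (Set.ext fun x ↦ ⟨fun h ↦ ?_, fun h ↦ ?_⟩)⟩
  · rw [← hinv g x]
    exact key g⁻¹ _ _ h
  · have := key g _ _ h
    have hp' := hinv g⁻¹ p
    rw [inv_inv] at hp'
    rwa [hp'] at this

/-- A half space is comparable with a cylinder of length one, up to complements. -/
theorem IsHalfSpace.nested {A : Set (ReducedList α)} (hA : IsHalfSpace A) (p : ReducedList α)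
    {a : α} (hp : p.1 = [a]) :
    A ⊆ cylinder p ∨ A ⊆ (cylinder p)ᶜ ∨ Aᶜ ⊆ cylinder p ∨ Aᶜ ⊆ (cylinder p)ᶜ := by
  have key (q : ReducedList α) (hq : q.1 ≠ []) :
      cylinder q ⊆ cylinder p ∨ cylinder q ⊆ (cylinder p)ᶜ := by
    obtain ⟨b, l, hbl⟩ := List.exists_cons_of_ne_nil hq
    by_cases hab : a = b
    · refine .inl fun x hx ↦ List.IsPrefix.trans (l₂ := q.1) ?_ hx
      rw [hp, hbl, hab]
      simp
    · refine .inr fun x (hx : q.1 <+: x.1) (hx' : p.1 <+: x.1) ↦ hab ?_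
      rw [hbl] at hx
      rw [hp] at hx'
      obtain ⟨t, ht⟩ := hx
      obtain ⟨t', ht'⟩ := hx'
      have := ht'.trans ht.symm
      simp at this
      exact this.1
  obtain ⟨q, hq, rfl | rfl⟩ := hA
  · rcases key q hq with h | h
    · exact .inl h
    · exact .inr (.inl h)
  · rw [compl_compl]
    exact .inr (.inr (key q hq))

end ReducedList

namespace CoxeterSystem

variable (cs : CoxeterSystem M W) (i : B)

/-- The generator `i` toggles its simple reflection, the other generators act by conjugation. -/
noncomputable def listActionFun (k : B) : Function.End (ReducedList W) :=
  if k = i then ReducedList.toggle (cs.simple i) else ReducedList.conj (cs.simple k)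

variable {i}

theorem isLiftable_listActionFun (h : ∀ j : B, j ≠ i → M i j = 2 ∨ M i j = 0) :
    M.IsLiftable (cs.listActionFun i) := by
  have hcomm (j : B) (hj : j ≠ i) (hm : M i j = 2) : Commute (cs.simple j) (cs.simple i) := by
    have := cs.simple_mul_simple_pow' i j
    rwa [hm, pow_two, mul_eq_one_iff_eq_inv, mul_inv_rev, cs.inv_simple, cs.inv_simple] at this
  have hsq (l : ReducedList W) (j : B) :
      ReducedList.conj (cs.simple j) (ReducedList.conj (cs.simple j) l) = l := by
    change (ReducedList.conj (cs.simple j) * ReducedList.conj (cs.simple j)) l = l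
    rw [← map_mul, cs.simple_mul_simple_self, map_one]
    rfl
  intro j k
  by_cases hj : j = i <;> by_cases hk : k = i
  · subst hj
    subst hk
    rw [M.diagonal, pow_one]
    funext l
    simp only [listActionFun, if_true]
    exact ReducedList.toggle_toggle _ l
  · subst hj
    rcases h k hk with hm | hm
    · rw [hm, pow_two]
      funext l
      simp only [listActionFun, if_true, hk, if_false]
      change ReducedList.toggle _ (ReducedList.conj _ (ReducedList.toggle _
        (ReducedList.conj _ l))) = l
      rw [ReducedList.conj_toggle (hcomm k hk hm), ReducedList.toggle_toggle, hsq]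
    · rw [hm, pow_zero]
  · subst hk
    rw [M.symmetric]
    rcases h j hj with hm | hm
    · rw [hm, pow_two]
      funext l
      simp only [listActionFun, if_true, hj, if_false]
      change ReducedList.conj _ (ReducedList.toggle _ (ReducedList.conj _
        (ReducedList.toggle _ l))) = l
      rw [← ReducedList.conj_toggle (hcomm j hj hm), ReducedList.toggle_toggle, hsq]
    · rw [hm, pow_zero]
  · simp only [listActionFun, hj, hk, if_false]
    rw [← map_mul, ← map_pow, cs.simple_mul_simple_pow, map_one]

variable (h : ∀ j : B, j ≠ i → M i j = 2 ∨ M i j = 0)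

/-- The action on reduced lists of a Coxeter group whose generator `i` satisfies the condition
on matrix entries. -/
noncomputable def listAction : W →* Function.End (ReducedList W) :=
  cs.lift ⟨cs.listActionFun i, cs.isLiftable_listActionFun h⟩

theorem listAction_simple_self :
    cs.listAction h (cs.simple i) = ReducedList.toggle (cs.simple i) := by
  simp [listAction, cs.lift_apply_simple, listActionFun]

theorem listAction_simple_of_ne {k : B} (hk : k ≠ i) :
    cs.listAction h (cs.simple k) = ReducedList.conj (cs.simple k) := by
  simp [listAction, cs.lift_apply_simple, listActionFun, hk]

theorem listAction_one_apply (l : ReducedList W) : cs.listAction h 1 l = l := by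
  rw [map_one]
  rfl

theorem listAction_mul_apply (v w : W) (l : ReducedList W) :
    cs.listAction h (v * w) l = cs.listAction h v (cs.listAction h w l) := by
  rw [map_mul]
  rfl

theorem isHalfSpace_preimage_listAction (w : W) {A : Set (ReducedList W)}
    (hA : ReducedList.IsHalfSpace A) : ReducedList.IsHalfSpace (cs.listAction h w ⁻¹' A) := by
  induction w using cs.simple_induction_right generalizing A with
  | one =>
    rw [map_one]
    exact hA
  | mul_simple_right w k ih =>
    have hw : cs.listAction h (w * cs.simple k) ⁻¹' A =
        cs.listAction h (cs.simple k) ⁻¹' (cs.listAction h w ⁻¹' A) :=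
      Set.ext fun l ↦ Set.mem_preimage.trans (by rw [listAction_mul_apply]; rfl)
    rw [hw]
    by_cases hk : k = i
    · subst hk
      rw [listAction_simple_self]
      exact ReducedList.isHalfSpace_preimage_toggle _ (ih hA)
    · rw [listAction_simple_of_ne cs h hk]
      exact ReducedList.isHalfSpace_preimage_conj _ (ih hA)

theorem exists_listAction_twist (w : W) : ∃ k : W,
    (∀ l, (cs.listAction h w l).1.prod * k = w * l.1.prod) ∧
      ∀ q x y, ReducedList.Adjacent q x y →
        ReducedList.Adjacent (k * q * k⁻¹) (cs.listAction h w x) (cs.listAction h w y) := by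
  induction w using cs.simple_induction_left with
  | one => exact ⟨1, by simp [listAction_one_apply], by simp [listAction_one_apply]⟩
  | mul_simple_left w j ih =>
    obtain ⟨k, hk, hadj⟩ := ih
    by_cases hj : j = i
    · subst hj
      refine ⟨k, fun l ↦ ?_, fun q x y hxy ↦ ?_⟩
      · rw [listAction_mul_apply, listAction_simple_self, mul_assoc, ← hk, ← mul_assoc,
          ← ReducedList.prod_toggleHead (cs.simple_mul_simple_self j)]
        rfl
      · simp only [listAction_mul_apply, listAction_simple_self]
        exact (hadj q x y hxy).toggle _
    · refine ⟨cs.simple j * k, fun l ↦ ?_, fun q x y hxy ↦ ?_⟩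
      · rw [listAction_mul_apply, listAction_simple_of_ne cs h hj, ReducedList.coe_conj_apply,
          ReducedList.prod_map_conj, mul_assoc (cs.simple j) w, ← hk]
        group
      · simp only [listAction_mul_apply, listAction_simple_of_ne cs h hj]
        convert (hadj q x y hxy).conj (cs.simple j) using 1
        group

/-- The empty reduced list. -/
def emptyList : ReducedList W := ⟨[], List.isChain_nil⟩

/-- The reduced list consisting of one simple reflection. -/
def simpleList (i : B) : ReducedList W := ⟨[cs.simple i], List.isChain_singleton _⟩

theorem listAction_emptyList_of_ne {k : B} (hk : k ≠ i) :
    cs.listAction h (cs.simple k) emptyList = emptyList := by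
  rw [listAction_simple_of_ne cs h hk]
  rfl

theorem adjacent_listAction_emptyList :
    ReducedList.Adjacent (cs.simple i) emptyList (cs.listAction h (cs.simple i) emptyList) := by
  rw [listAction_simple_self]
  exact .inl rfl

/-- A word leading into the cylinder of `i` contains a letter whose deletion multiplies the
product by `i` from the left. -/
theorem exists_shorter_word (ω : List B)
    (hω : cs.listAction h (cs.wordProd ω) emptyList ∈ ReducedList.cylinder (cs.simpleList i)) :
    ∃ ω' : List B, ω'.length < ω.length ∧ cs.wordProd ω' = cs.simple i * cs.wordProd ω := by
  induction ω using List.reverseRecOn with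
  | nil =>
    exfalso
    rw [cs.wordProd_nil, listAction_one_apply] at hω
    simp [ReducedList.cylinder, simpleList, emptyList] at hω
  | append_singleton ω k ih =>
    by_cases hmem : cs.listAction h (cs.wordProd ω) emptyList ∈
        ReducedList.cylinder (cs.simpleList i)
    · obtain ⟨ω', hlen, hprod⟩ := ih hmem
      refine ⟨ω' ++ [k], by simpa using hlen, ?_⟩
      rw [cs.wordProd_append, cs.wordProd_append, hprod, mul_assoc]
    · rw [cs.wordProd_append, cs.wordProd_singleton, listAction_mul_apply] at hω
      by_cases hk : k = i
      · subst hk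
        obtain ⟨c, hc, hadj⟩ := cs.exists_listAction_twist h (cs.wordProd ω)
        have hc := hc emptyList
        have hadj := hadj _ _ _ (cs.adjacent_listAction_emptyList h)
        generalize cs.listAction h (cs.wordProd ω) emptyList = x at *
        generalize cs.listAction h (cs.wordProd ω) _ = y at *
        obtain ⟨t, ht⟩ := hω
        simp only [simpleList] at ht
        rcases hadj with hadj | hadj
        · obtain hx | ⟨b, l, hx⟩ : x.1 = [] ∨ ∃ b l, x.1 = b :: l := by
            cases x.1 <;> simp
          · rw [hx, ← ht] at hadj
            rw [hx] at hc
            simp only [emptyList, List.prod_nil, one_mul, mul_one] at hc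
            simp only [List.cons_append, List.nil_append, List.cons.injEq] at hadj
            refine ⟨ω, by simp, ?_⟩
            have := hadj.1
            rw [hc, eq_mul_inv_iff_mul_eq] at this
            rw [cs.wordProd_append, cs.wordProd_singleton, ← this,
              cs.simple_mul_simple_cancel_left]
          · rw [hx, ← ht] at hadj
            simp only [List.cons_append, List.nil_append, List.cons.injEq] at hadj
            refine (hmem ⟨l, ?_⟩).elim
            rw [hx, ← hadj.1]
            rfl
        · refine (hmem ⟨t ++ [c * cs.simple k * c⁻¹], ?_⟩).elim
          rw [hadj, ← ht]
          rfl
      · rw [listAction_emptyList_of_ne cs h hk] at hω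
        exact (hmem hω).elim

theorem mem_Hm_iff (w : W) : w ∈ Hm cs i ↔
    cs.listAction h w emptyList ∈ ReducedList.cylinder (cs.simpleList i) := by
  have key (w : W)
      (hw : cs.listAction h w emptyList ∈ ReducedList.cylinder (cs.simpleList i)) :
      w ∈ Hm cs i := by
    obtain ⟨ω, hω, rfl⟩ := cs.exists_isReduced w
    obtain ⟨ω', hlen, hprod⟩ := cs.exists_shorter_word h ω hw
    have := cs.length_wordProd_le ω'
    rw [hprod] at this
    simp only [Hm, Set.mem_ofPred_eq, hω.eq]
    lia
  refine ⟨fun hw ↦ ?_, key w⟩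
  by_contra hw'
  have := key (cs.simple i * w) <| by
    rw [listAction_mul_apply, listAction_simple_self]
    exact (ReducedList.singleton_prefix_toggleHead _ (Subtype.prop _)).2 hw'
  simp only [Hm, Set.mem_ofPred_eq, cs.simple_mul_simple_cancel_left] at this hw
  lia

end CoxeterSystem

theorem nested_of_matrix_entries (cs : CoxeterSystem M W) {i : B}
    (h : ∀ j : B, j ≠ i → (M i j = 2 ∨ M i j = 0)) : Nested cs i := by
  intro g
  set C := ReducedList.cylinder (cs.simpleList i) with hC
  let f (w : W) : ReducedList W := cs.listAction h w CoxeterSystem.emptyList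
  have hm : Hm cs i = f ⁻¹' C := Set.ext (cs.mem_Hm_iff h)
  have hp : Hp cs i = f ⁻¹' Cᶜ := by rw [← compl_compl (Hp cs i), compl_Hp, hm]; rfl
  set A := cs.listAction h g⁻¹ ⁻¹' C with hA
  have hgm : g • Hm cs i = f ⁻¹' A := by
    ext w
    rw [Set.mem_smul_set_iff_inv_smul_mem, hm, smul_eq_mul]
    simp only [f, A, Set.mem_preimage, cs.listAction_mul_apply]
    rfl
  have hgp : g • Hp cs i = f ⁻¹' Aᶜ := by
    rw [← compl_compl (Hp cs i), compl_Hp, Set.smul_set_compl, hgm]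
    rfl
  have hgc : (g • Hm cs i)ᶜ = g • Hp cs i := by rw [← compl_Hp, Set.smul_set_compl, compl_compl]
  have hHS : ReducedList.IsHalfSpace A := cs.isHalfSpace_preimage_listAction h g⁻¹
    ⟨cs.simpleList i, by simp [CoxeterSystem.simpleList], .inl rfl⟩
  unfold NestedAt
  rcases hHS.nested (cs.simpleList i) rfl with H | H | H | H <;>
    replace H := Set.preimage_mono (f := f) H
  · rw [← hgm, ← hC, ← hm] at H
    rcases H.eq_or_ssubset with H | H
    · rw [← hgc, H, ← compl_Hp, compl_compl]
      exact .inl rfl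
    · tauto
  · rw [← hgm, ← hC, ← hp] at H
    rcases H.eq_or_ssubset with H | H
    · rw [← hgc, H, compl_Hp]
      exact .inr (.inl rfl)
    · tauto
  · rw [← hgp, ← hC, ← hm] at H
    rcases H.eq_or_ssubset with H | H <;> tauto
  · rw [← hgp, ← hC, ← hp] at H
    rcases H.eq_or_ssubset with H | H <;> tauto

/-- `W` satisfies the nested condition relative to `s` iff for every other generator `u`,
the Coxeter matrix entry `m_{su}` is `2` or `∞` (encoded as `0`). -/
theorem nested_iff_matrix_entries (cs : CoxeterSystem M W) (i : B) :
    Nested cs i ↔ ∀ j : B, j ≠ i → (M i j = 2 ∨ M i j = 0) := by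
  exact ⟨fun h j hj ↦ eq_two_or_zero_of_nested cs hj (h _), nested_of_matrix_entries cs⟩
end

section
/- Let (W,S) be a right-angled Coxeter system, i.e. m_{st} ∈ {2, ∞} for all s ≠ t in S. Then W satisfies the nested condition relative to every generator s ∈ S. -/
open Pointwise
open scoped Classical

variable {B : Type*} {W : Type*} [Group W] {M : CoxeterMatrix B}

namespace RightAngled

/-- The Coxeter matrix has only the entries `2` and `0` (that is, `∞`) off the diagonal. -/
def IsRightAngled (M : CoxeterMatrix B) : Prop :=
  ∀ i j : B, i ≠ j → (M i j = 2 ∨ M i j = 0)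

theorem simple_commute (cs : CoxeterSystem M W) {i j : B} (h : M i j = 2) :
    cs.simple i * cs.simple j = cs.simple j * cs.simple i := by
  have h1 := cs.simple_mul_simple_pow i j
  rw [h, pow_two] at h1
  have := eq_inv_of_mul_eq_one_left h1
  simpa using this

/-- A family of elements of a monoid lifts to a right-angled Coxeter group as soon as it
consists of involutions which commute whenever the matrix entry is `2`. -/
theorem isLiftable_of_commute (hra : IsRightAngled M) {G : Type*} [Monoid G] (f : B → G)
    (hsq : ∀ i, f i * f i = 1) (hcomm : ∀ i j, i ≠ j → M i j = 2 → f i * f j = f j * f i) :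
    M.IsLiftable f := by
  intro i j
  by_cases hij : i = j
  · subst hij
    rw [M.diagonal, pow_one, hsq]
  · rcases hra i j hij with h | h
    · rw [h, pow_two]
      calc f i * f j * (f i * f j) = f i * (f j * f i) * f j := by simp only [mul_assoc]
        _ = f i * f i * (f j * f j) := by rw [← hcomm i j hij h]; simp only [mul_assoc]
        _ = 1 := by rw [hsq, hsq, one_mul]
    · rw [h, pow_zero]

/-- Conjugate simple reflections of a right-angled Coxeter group are equal. -/
theorem eq_of_conj (cs : CoxeterSystem M W) (hra : IsRightAngled M) {i j : B} {w : W}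
    (h : w⁻¹ * cs.simple i * w = cs.simple j) : i = j := by
  have hl : M.IsLiftable (fun k : B => if k = i then (-1 : ℤˣ) else 1) :=
    isLiftable_of_commute hra _ (fun k => by split_ifs <;> simp) (fun _ _ _ _ => mul_comm _ _)
  have h1 := congrArg (cs.lift ⟨_, hl⟩) h
  rw [map_mul, map_mul, mul_comm, ← mul_assoc, ← map_mul, mul_inv_cancel, map_one, one_mul,
    cs.lift_apply_simple hl, cs.lift_apply_simple hl] at h1
  by_contra hij
  rw [if_pos rfl, if_neg (Ne.symm hij)] at h1
  exact absurd h1 (by decide)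

/-- The action of a simple reflection on signed group elements. -/
noncomputable def signedConj (cs : CoxeterSystem M W) (j : B) : Function.End (W × ZMod 2) :=
  fun p => (cs.simple j * p.1 * cs.simple j, p.2 + if p.1 = cs.simple j then 1 else 0)

theorem signedConj_isLiftable (cs : CoxeterSystem M W) (hra : IsRightAngled M) :
    M.IsLiftable (signedConj cs) := by
  refine isLiftable_of_commute hra _ (fun i => ?_) (fun i j _ h => ?_)
  · funext ⟨t, e⟩
    have h1 : cs.simple i * t * cs.simple i = cs.simple i ↔ t = cs.simple i := by
      rw [mul_eq_right, mul_eq_one_iff_eq_inv', cs.inv_simple]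
    change signedConj cs i (signedConj cs i (t, e)) = (t, e)
    simp only [signedConj, h1, Prod.mk.injEq]
    refine ⟨by simp [mul_assoc], ?_⟩
    rw [add_assoc, CharTwo.add_self_eq_zero, add_zero]
  · have hc := simple_commute cs h
    have key : ∀ {a b : B}, cs.simple a * cs.simple b = cs.simple b * cs.simple a →
        ∀ t, cs.simple a * t * cs.simple a = cs.simple b ↔ t = cs.simple b := by
      intro a b hab t
      constructor
      · intro ht
        have : t = cs.simple a * (cs.simple a * t * cs.simple a) * cs.simple a := by
          simp [mul_assoc]
        rw [this, ht, hab, mul_assoc, cs.simple_mul_simple_self, mul_one]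
      · rintro rfl
        rw [hab, mul_assoc, cs.simple_mul_simple_self, mul_one]
    funext ⟨t, e⟩
    change signedConj cs i (signedConj cs j (t, e)) = signedConj cs j (signedConj cs i (t, e))
    simp only [signedConj, key hc, key hc.symm, Prod.mk.injEq]
    refine ⟨?_, by ring⟩
    calc _ = (cs.simple i * cs.simple j) * t * (cs.simple j * cs.simple i) := by
          simp only [mul_assoc]
      _ = (cs.simple j * cs.simple i) * t * (cs.simple i * cs.simple j) := by rw [hc]
      _ = _ := by simp only [mul_assoc]

/-- The action of a right-angled Coxeter group on signed group elements. -/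
noncomputable def signedAction (cs : CoxeterSystem M W) (hra : IsRightAngled M) :
    W →* Function.End (W × ZMod 2) :=
  cs.lift ⟨_, signedConj_isLiftable cs hra⟩

/-- For a reflection `t`, the side of the wall of `t` on which `w` lies, `0` being the side
of the identity. -/
noncomputable def side (cs : CoxeterSystem M W) (hra : IsRightAngled M) (t w : W) : ZMod 2 :=
  (signedAction cs hra w⁻¹ (t, 0)).2

section

variable (cs : CoxeterSystem M W) (hra : IsRightAngled M)

theorem signedAction_simple (j : B) (p : W × ZMod 2) :
    signedAction cs hra (cs.simple j) p = signedConj cs j p := by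
  rw [signedAction, cs.lift_apply_simple (signedConj_isLiftable cs hra)]

theorem signedAction_mul (x y : W) (p : W × ZMod 2) :
    signedAction cs hra (x * y) p = signedAction cs hra x (signedAction cs hra y p) := by
  rw [map_mul]; rfl

theorem signedAction_apply (w t : W) (e : ZMod 2) :
    signedAction cs hra w (t, e) = (w * t * w⁻¹, e + (signedAction cs hra w (t, 0)).2) := by
  induction w using cs.simple_induction_left generalizing e with
  | one => simp only [map_one]; simp [Function.End.one_def]
  | mul_simple_left w i ih =>
    rw [signedAction_mul, signedAction_mul, ih, ih 0, signedAction_simple, signedAction_simple]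
    simp only [signedConj, mul_inv_rev, cs.inv_simple, mul_assoc, add_assoc, zero_add]

theorem side_mul (t x y : W) :
    side cs hra t (x * y) = side cs hra t x + side cs hra (x⁻¹ * t * x) y := by
  unfold side
  rw [mul_inv_rev, signedAction_mul, signedAction_apply cs hra x⁻¹, signedAction_apply, inv_inv,
    zero_add]

theorem side_one (t : W) : side cs hra t 1 = 0 := by
  have h := side_mul cs hra t 1 1
  simpa using h

theorem side_simple (t : W) (j : B) :
    side cs hra t (cs.simple j) = if t = cs.simple j then 1 else 0 := by
  unfold side
  rw [cs.inv_simple, signedAction_simple]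
  simp [signedConj]

theorem side_mul_simple (t w : W) (j : B) :
    side cs hra t (w * cs.simple j) =
      side cs hra t w + if w⁻¹ * t * w = cs.simple j then 1 else 0 := by
  rw [side_mul, side_simple]

theorem length_mul_lt_of_side_eq_one {t w : W} (h : side cs hra t w = 1) :
    cs.length (t * w) < cs.length w := by
  induction hn : cs.length w using Nat.strong_induction_on generalizing w with
  | _ n ih =>
    subst hn
    have hw : w ≠ 1 := by
      rintro rfl
      rw [side_one] at h
      exact absurd h (by decide)
    obtain ⟨j, hj⟩ := cs.exists_rightDescent_of_ne_one hw
    have hlt : cs.length (w * cs.simple j) < cs.length w := hj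
    set v := w * cs.simple j with hv
    have hwv : w = v * cs.simple j := by simp [hv]
    by_cases hc : v⁻¹ * t * v = cs.simple j
    · have : t * w = v := by
        have h1 : t * v = w := by
          rw [hwv, ← hc, mul_assoc v⁻¹, mul_inv_cancel_left]
        rw [hwv, ← mul_assoc, h1]
      rwa [this]
    · have hs : side cs hra t v = 1 := by
        rw [hwv, side_mul_simple, if_neg hc, add_zero] at h
        exact h
      have h1 := ih _ hlt hs rfl
      have h2 := cs.length_mul_simple (t * v) j
      rw [mul_assoc, ← hwv] at h2
      omega

theorem side_simple_mul_self (i : B) (w : W) :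
    side cs hra (cs.simple i) (cs.simple i * w) = 1 + side cs hra (cs.simple i) w := by
  rw [side_mul, side_simple, if_pos rfl]
  simp

theorem zmod_two_cases (a : ZMod 2) : a = 0 ∨ a = 1 := by
  revert a; decide

theorem mem_Hm_iff (i : B) (w : W) : w ∈ Hm cs i ↔ side cs hra (cs.simple i) w = 1 := by
  refine ⟨fun h => ?_, fun h => length_mul_lt_of_side_eq_one cs hra h⟩
  by_contra h1
  have h0 := (zmod_two_cases (side cs hra (cs.simple i) w)).resolve_right h1
  have h2 : side cs hra (cs.simple i) (cs.simple i * w) = 1 := by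
    rw [side_simple_mul_self, h0, add_zero]
  have h3 := length_mul_lt_of_side_eq_one cs hra h2
  rw [cs.simple_mul_simple_cancel_left] at h3
  exact lt_asymm h h3

theorem compl_Hm (i : B) : (Hm cs i)ᶜ = Hp cs i := by
  ext w
  have := cs.length_simple_mul_ne w i
  simp only [Hm, Hp, Set.mem_compl_iff, Set.mem_ofPred_eq]
  omega

theorem mem_Hp_iff (i : B) (w : W) : w ∈ Hp cs i ↔ side cs hra (cs.simple i) w = 0 := by
  rw [← compl_Hm, Set.mem_compl_iff, mem_Hm_iff cs hra]
  generalize side cs hra (cs.simple i) w = a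
  revert a; decide

/-- The reflection representation on `ℤ` of the infinite dihedral group on `i` and `j`, the
other generators acting trivially. -/
noncomputable def dihedralMap (i j k : B) : Function.End ℤ :=
  fun x => if k = i then -1 - x else if k = j then 1 - x else x

theorem dihedralMap_isLiftable (hra : IsRightAngled M) {i j : B} (h : M i j = 0) :
    M.IsLiftable (dihedralMap i j) := by
  refine isLiftable_of_commute hra _ (fun k => ?_) (fun k l hkl hM => ?_)
  · funext x
    change dihedralMap i j k (dihedralMap i j k x) = x
    unfold dihedralMap
    split_ifs <;> ring
  · funext x
    change dihedralMap i j k (dihedralMap i j l x) = dihedralMap i j l (dihedralMap i j k x)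
    have h' : M j i = 0 := by rw [M.symmetric, h]
    unfold dihedralMap
    split_ifs <;> simp_all

theorem length_alternating (hra : IsRightAngled M) {i j : B} (h : M i j = 0) (n : ℕ) :
    cs.length (cs.wordProd (CoxeterSystem.alternatingWord i j n)) = n := by
  have hij : i ≠ j := by
    rintro rfl
    rw [M.diagonal] at h
    exact absurd h (by decide)
  have hl := dihedralMap_isLiftable hra h
  set ρ := cs.lift ⟨_, hl⟩ with hρ
  have hmul : ∀ (w : W) (k : B) (x : ℤ), ρ (w * cs.simple k) x = ρ w (dihedralMap i j k x) := by
    intro w k x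
    rw [map_mul, hρ, cs.lift_apply_simple hl]
    rfl
  have hone : ∀ x : ℤ, ρ 1 x = x := by
    intro x
    rw [map_one]; rfl
  have upper : ∀ (ω : List B), (ρ (cs.wordProd ω) 0).natAbs ≤ ω.length := by
    intro ω
    induction ω with
    | nil => simp [hone]
    | cons k ω ih =>
      rw [cs.wordProd_cons, map_mul, hρ, cs.lift_apply_simple hl, ← hρ]
      change (dihedralMap i j k (ρ (cs.wordProd ω) 0)).natAbs ≤ _
      generalize ρ (cs.wordProd ω) 0 = y at *
      unfold dihedralMap
      rw [List.length_cons]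
      split_ifs <;> omega
  have exact_abs : ∀ n : ℕ,
      (∀ x : ℤ, 0 ≤ x →
        (ρ (cs.wordProd (CoxeterSystem.alternatingWord j i n)) x).natAbs = x.natAbs + n) ∧
      (∀ x : ℤ, x ≤ 0 →
        (ρ (cs.wordProd (CoxeterSystem.alternatingWord i j n)) x).natAbs = x.natAbs + n) := by
    intro n
    induction n with
    | zero => simp [CoxeterSystem.alternatingWord, hone]
    | succ n ih =>
      constructor
      · intro x hx
        rw [CoxeterSystem.alternatingWord_succ, cs.wordProd_concat, hmul]
        have e : dihedralMap i j i x = -1 - x := if_pos rfl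
        rw [e, ih.2 _ (by omega)]
        omega
      · intro x hx
        rw [CoxeterSystem.alternatingWord_succ, cs.wordProd_concat, hmul]
        have e : dihedralMap i j j x = 1 - x := by simp [dihedralMap, hij.symm]
        rw [e, ih.1 _ (by omega)]
        omega
  refine le_antisymm ?_ ?_
  · simpa using cs.length_wordProd_le (CoxeterSystem.alternatingWord i j n)
  · obtain ⟨ω, hω, hw⟩ :=
      cs.exists_isReduced (cs.wordProd (CoxeterSystem.alternatingWord i j n))
    have h1 := (exact_abs n).2 0 le_rfl
    have h2 := upper ω
    rw [← hw, h1] at h2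
    have h3 := hω.eq
    rw [← hw] at h3
    simpa [h3] using h2

/-- If `w` is on the negative side of both `i` and `j` and `M i j = ∞`, then left multiplication
by alternating words keeps decreasing the length. -/
theorem length_alternating_mul_add_le {i j : B} (h : M i j = 0) {w : W}
    (hi : side cs hra (cs.simple i) w = 1) (hj : side cs hra (cs.simple j) w = 1) (n : ℕ) :
    cs.length (cs.wordProd (CoxeterSystem.alternatingWord i j n) * w) + n ≤ cs.length w := by
  induction n generalizing i j with
  | zero => simp [CoxeterSystem.alternatingWord]
  | succ n ih =>
    have h' : M j i = 0 := by rw [M.symmetric, h]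
    have hn := length_alternating cs hra h (n + 1)
    have hn' := length_alternating cs hra h' n
    have hle := ih h' hj hi
    rw [CoxeterSystem.alternatingWord_succ, cs.wordProd_concat] at hn ⊢
    set a := cs.wordProd (CoxeterSystem.alternatingWord j i n)
    have ha : side cs hra (cs.simple j) a⁻¹ = 0 := by
      refine (zmod_two_cases _).resolve_right fun h1 => ?_
      have := length_mul_lt_of_side_eq_one cs hra h1
      rw [cs.length_inv, ← cs.length_inv, mul_inv_rev, inv_inv, cs.inv_simple] at this
      omega
    have hs : side cs hra (a * cs.simple j * a⁻¹) (a * w) = 1 := by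
      have := side_mul cs hra (cs.simple j) a⁻¹ (a * w)
      rw [inv_mul_cancel_left, hj, ha, zero_add, inv_inv] at this
      exact this.symm
    have := length_mul_lt_of_side_eq_one cs hra hs
    rw [show a * cs.simple j * a⁻¹ * (a * w) = a * cs.simple j * w by
      simp only [mul_assoc, inv_mul_cancel_left]] at this
    omega

/-- The negative roots of two generators `i`, `j` with `M i j = ∞` are disjoint. -/
theorem not_side_eq_one_and {i j : B} (h : M i j = 0) {w : W}
    (hi : side cs hra (cs.simple i) w = 1) (hj : side cs hra (cs.simple j) w = 1) : False := by
  have := length_alternating_mul_add_le cs hra h hi hj (cs.length w + 1)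
  omega

/-- The centralizer of a generator is generated by the generators commuting with it. -/
theorem mem_closure_of_commute (hra : IsRightAngled M) {i : B} {w : W} (h : Commute (cs.simple i) w) :
    w ∈ Subgroup.closure {x | ∃ k, x = cs.simple k ∧ Commute (cs.simple i) x} := by
  induction hn : cs.length w using Nat.strong_induction_on generalizing w with
  | _ n ih =>
    subst hn
    by_cases hw : w = 1
    · rw [hw]; exact one_mem _
    obtain ⟨j, hj⟩ := cs.exists_leftDescent_of_ne_one hw
    have hlt : cs.length (cs.simple j * w) < cs.length w := hj
    by_cases hc : Commute (cs.simple i) (cs.simple j)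
    · have hmem := ih _ hlt (hc.mul_right h) rfl
      have := mul_mem (Subgroup.subset_closure (Set.mem_ofPred.2 ⟨j, rfl, hc⟩)) hmem
      rwa [cs.simple_mul_simple_cancel_left] at this
    · have hij : i ≠ j := by
        rintro rfl
        exact hc (Commute.refl _)
      have hM : M i j = 0 := (hra i j hij).resolve_left fun h2 => hc (simple_commute cs h2)
      have hj1 : side cs hra (cs.simple j) w = 1 := (mem_Hm_iff cs hra j w).1 hj
      rcases zmod_two_cases (side cs hra (cs.simple i) w) with h0 | h1
      · refine (not_side_eq_one_and cs hra hM (w := cs.simple i * w) ?_ ?_).elim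
        · rw [side_simple_mul_self, h0, add_zero]
        · rw [h.eq, side_mul_simple, hj1, if_neg, add_zero]
          exact fun h2 => hij (eq_of_conj cs hra h2).symm
      · exact (not_side_eq_one_and cs hra hM h1 hj1).elim

/-- If `g` does not centralize the generator `i`, then `g` times the centralizer of `i` lies on
one side of the wall of `i`. -/
theorem side_mul_of_commute {i : B} {z g : W} (hz : Commute (cs.simple i) z)
    (hg : ¬ Commute (cs.simple i) g) :
    side cs hra (cs.simple i) (g * z) = side cs hra (cs.simple i) g := by
  have hcl := mem_closure_of_commute cs hra hz
  clear hz
  suffices H : Commute (cs.simple i) z ∧ ∀ g : W, ¬ Commute (cs.simple i) g →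
      side cs hra (cs.simple i) (g * z) = side cs hra (cs.simple i) g from H.2 g hg
  have hmul : ∀ {x g : W}, Commute (cs.simple i) x → ¬ Commute (cs.simple i) g →
      ¬ Commute (cs.simple i) (g * x) := by
    intro x g hx hg h
    exact hg (by simpa using h.mul_right hx.inv_right)
  induction hcl using Subgroup.closure_induction with
  | mem x hx =>
    obtain ⟨k, rfl, hk⟩ := hx
    refine ⟨hk, fun g hg => ?_⟩
    rw [side_mul_simple, if_neg, add_zero]
    intro h
    obtain rfl := eq_of_conj cs hra h
    exact hg (by rw [mul_assoc, inv_mul_eq_iff_eq_mul] at h; exact h)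
  | one => exact ⟨Commute.one_right _, fun g _ => by rw [mul_one]⟩
  | mul x y _ _ hx hy =>
    refine ⟨hx.1.mul_right hy.1, fun g hg => ?_⟩
    rw [← mul_assoc, hy.2 _ (hmul hx.1 hg), hx.2 _ hg]
  | inv x _ hx =>
    refine ⟨hx.1.inv_right, fun g hg => ?_⟩
    rw [← hx.2 _ (hmul hx.1.inv_right hg), inv_mul_cancel_right]

/-- Positive roots are gallery-connected. -/
theorem eq_apply_one_of_side_eq_zero {α : Type*} {i : B} (Q : W → α)
    (hQ : ∀ x k, side cs hra (cs.simple i) x = 0 →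
      side cs hra (cs.simple i) (x * cs.simple k) = 0 → Q (x * cs.simple k) = Q x)
    {w : W} (h : side cs hra (cs.simple i) w = 0) : Q w = Q 1 := by
  induction hn : cs.length w using Nat.strong_induction_on generalizing w with
  | _ n ih =>
    subst hn
    by_cases hw : w = 1
    · rw [hw]
    obtain ⟨j, hj⟩ := cs.exists_rightDescent_of_ne_one hw
    have hlt : cs.length (w * cs.simple j) < cs.length w := hj
    have h0 : side cs hra (cs.simple i) (w * cs.simple j) = 0 := by
      rw [← mem_Hp_iff] at h ⊢
      have h1 : cs.length w < cs.length (cs.simple i * w) := h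
      have h2 := cs.length_mul_simple (cs.simple i * w) j
      change cs.length _ < cs.length (cs.simple i * (w * cs.simple j))
      rw [← mul_assoc]
      omega
    rw [← hQ w j h h0]
    exact ih _ hlt h0 rfl

/-- Both roots of a generator are gallery-connected. -/
theorem exists_eq_of_side_eq {α : Type*} {i : B} (Q : W → α) (e : ZMod 2)
    (hQ : ∀ x k, side cs hra (cs.simple i) x = e →
      side cs hra (cs.simple i) (x * cs.simple k) = e → Q (x * cs.simple k) = Q x) :
    ∃ c, ∀ w, side cs hra (cs.simple i) w = e → Q w = c := by
  rcases zmod_two_cases e with rfl | rfl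
  · exact ⟨Q 1, fun w => eq_apply_one_of_side_eq_zero cs hra Q hQ⟩
  · refine ⟨Q (cs.simple i * 1), fun w hw => ?_⟩
    have hflip : ∀ x, side cs hra (cs.simple i) x = 0 →
        side cs hra (cs.simple i) (cs.simple i * x) = 1 := fun x hx => by
      rw [side_simple_mul_self, hx, add_zero]
    have := eq_apply_one_of_side_eq_zero cs hra (i := i) (w := cs.simple i * w)
      (fun y => Q (cs.simple i * y)) (fun x k hx hxk => ?_) ?_
    · simpa using this
    · have h := hQ (cs.simple i * x) k (hflip x hx)
      rw [mul_assoc] at h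
      exact h (hflip _ hxk)
    · rw [side_simple_mul_self, hw]; decide

/-- If `g` does not centralize the generator `i`, then some `g`-translate of a root of `i` is
contained in a root of `i`. -/
theorem exists_side_imp_side {i : B} {g : W} (hg : ¬ Commute (cs.simple i) g) :
    ∃ c d : ZMod 2, ∀ x, side cs hra (cs.simple i) (g⁻¹ * x) = c →
      side cs hra (cs.simple i) x = d := by
  set d := side cs hra (cs.simple i) g with hd
  obtain ⟨c, hc⟩ := exists_eq_of_side_eq cs hra (i := i)
    (fun x => side cs hra (cs.simple i) (g⁻¹ * x)) (d + 1) (fun x k hx _ => by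
      rw [← mul_assoc, side_mul_simple, if_neg, add_zero]
      intro h
      obtain rfl := eq_of_conj cs hra h
      have hz : Commute (cs.simple i) (g⁻¹ * x) := by
        rw [mul_assoc _ (cs.simple i), inv_mul_eq_iff_eq_mul] at h
        exact h
      have h1 := side_mul_of_commute cs hra hz hg
      rw [mul_inv_cancel_left, hx, ← hd] at h1
      simp at h1)
  refine ⟨c + 1, d, fun x hx => ?_⟩
  by_contra h
  have h1 : side cs hra (cs.simple i) x = d + 1 := by
    revert h
    generalize side cs hra (cs.simple i) x = a
    generalize d = b
    revert a b
    decide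
  have h2 := hc x h1
  simp only [hx] at h2
  simp at h2

/-- The root of the generator `i` with sign `e`. -/
def root (i : B) (e : ZMod 2) : Set W := {x | side cs hra (cs.simple i) x = e}

theorem root_zero (i : B) : root cs hra i 0 = Hp cs i :=
  Set.ext fun w => (mem_Hp_iff cs hra i w).symm

theorem root_one (i : B) : root cs hra i 1 = Hm cs i :=
  Set.ext fun w => (mem_Hm_iff cs hra i w).symm

theorem smul_root_subset {i : B} {g : W} (hg : Commute (cs.simple i) g) (e : ZMod 2) :
    g • root cs hra i e ⊆ root cs hra i (side cs hra (cs.simple i) g + e) := by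
  rintro _ ⟨x, hx, rfl⟩
  have hx : side cs hra (cs.simple i) x = e := hx
  change side cs hra (cs.simple i) (g * x) = _
  rw [side_mul, mul_assoc, hg.eq, inv_mul_cancel_left, hx]

end

theorem nestedAt_of_smul_Hm_eq {cs : CoxeterSystem M W} {i : B} {g : W}
    (h : g • Hm cs i = Hp cs i ∨ g • Hm cs i = Hm cs i) : NestedAt cs i g := by
  have hc : g • Hp cs i = (g • Hm cs i)ᶜ := by rw [← compl_Hm, Set.smul_set_compl]
  rcases h with h | h
  · exact Or.inr (Or.inl (by rw [hc, h, ← compl_Hm, compl_compl]))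
  · exact Or.inl (by rw [hc, h, compl_Hm])

theorem nestedAt_of_smul_subset (cs : CoxeterSystem M W) (hra : IsRightAngled M) {i : B} {g : W}
    {c d : ZMod 2} (h : g • root cs hra i c ⊆ root cs hra i d) : NestedAt cs i g := by
  have key := h.eq_or_ssubset
  rcases zmod_two_cases c with rfl | rfl <;> rcases zmod_two_cases d with rfl | rfl <;>
    simp only [root_zero, root_one] at key <;> rcases key with he | hs
  · exact Or.inl he
  · exact Or.inr (Or.inr (Or.inl hs))
  · exact Or.inr (Or.inl he)
  · exact Or.inr (Or.inr (Or.inr (Or.inl hs)))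
  · exact nestedAt_of_smul_Hm_eq (Or.inl he)
  · exact Or.inr (Or.inr (Or.inr (Or.inr (Or.inl hs))))
  · exact nestedAt_of_smul_Hm_eq (Or.inr he)
  · exact Or.inr (Or.inr (Or.inr (Or.inr (Or.inr hs))))

end RightAngled

/-- Right-angled Coxeter groups satisfy the nested condition relative to every generator. -/
theorem rightAngled_nested (cs : CoxeterSystem M W)
    (hra : ∀ i j : B, i ≠ j → (M i j = 2 ∨ M i j = 0)) :
    ∀ i : B, Nested cs i := by
  intro i g
  have hM : RightAngled.IsRightAngled M := hra
  by_cases hg : Commute (cs.simple i) g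
  · exact RightAngled.nestedAt_of_smul_subset cs hM (RightAngled.smul_root_subset cs hM hg 0)
  · obtain ⟨c, d, h⟩ := RightAngled.exists_side_imp_side cs hM hg
    refine RightAngled.nestedAt_of_smul_subset cs hM (c := c) (d := d) fun x hx => h x ?_
    exact Set.mem_smul_set_iff_inv_smul_mem.1 hx
end
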